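/- Let U ⊆ ℝ² be an open set, φ : U → ℝ smooth, A(h) = ∂ₓh + φ ∂ᵤh, 𝔖(h) = A(h) − (∂ᵤφ)h, and 𝒦 = −∂ᵤ(A(φ)). If a smooth function δ : U → ℝ satisfies A(A(δ)) + 𝒦·δ = 0 on U, then the 1-form 𝔖(δ)·(−φ dx + du) is closed on U, i.e. ∂ᵤ(−φ·𝔖(δ)) = ∂ₓ(𝔖(δ)). -/

import Mathlib

/-- Partial derivative with respect to the first variable `x`. -/
noncomputable def pdx (f : ℝ → ℝ → ℝ) (x u : ℝ) : ℝ := deriv (fun t => f t u) x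

/-- Partial derivative with respect to the second variable `u`. -/
noncomputable def pdu (f : ℝ → ℝ → ℝ) (x u : ℝ) : ℝ := deriv (fun t => f x t) u

/-- The vector field `A = ∂ₓ + φ ∂ᵤ` associated with the ODE `u' = φ(x,u)`. -/
noncomputable def Aop (φ h : ℝ → ℝ → ℝ) (x u : ℝ) : ℝ :=
  pdx h x u + φ x u * pdu h x u

/-- The operator `𝔖(h) = A(h) − (∂ᵤφ) h`. -/
noncomputable def Sfrak (φ h : ℝ → ℝ → ℝ) (x u : ℝ) : ℝ :=
  Aop φ h x u - pdu φ x u * h x u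

/-- The Gaussian curvature `𝒦 = −∂ᵤ(A(φ))` of the associated surface. -/
noncomputable def curvK (φ : ℝ → ℝ → ℝ) (x u : ℝ) : ℝ := -(pdu (Aop φ φ) x u)

section PartialDerivatives

variable {U : Set (ℝ × ℝ)} {f g : ℝ → ℝ → ℝ} {p : ℝ × ℝ}

theorem hasDerivAt_fst_of_differentiableAt
    (hf : DifferentiableAt ℝ (fun q : ℝ × ℝ => f q.1 q.2) p) :
    HasDerivAt (fun t => f t p.2) (fderiv ℝ (fun q : ℝ × ℝ => f q.1 q.2) p (1, 0)) p.1 :=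
  HasFDerivAt.comp_hasDerivAt (f := fun t : ℝ => (t, p.2)) p.1 hf.hasFDerivAt
    ((hasDerivAt_id p.1).prodMk (hasDerivAt_const p.1 p.2))

theorem hasDerivAt_snd_of_differentiableAt
    (hf : DifferentiableAt ℝ (fun q : ℝ × ℝ => f q.1 q.2) p) :
    HasDerivAt (fun t => f p.1 t) (fderiv ℝ (fun q : ℝ × ℝ => f q.1 q.2) p (0, 1)) p.2 :=
  HasFDerivAt.comp_hasDerivAt (f := fun t : ℝ => (p.1, t)) p.2 hf.hasFDerivAt
    ((hasDerivAt_const p.2 p.1).prodMk (hasDerivAt_id p.2))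

theorem pdx_eq_fderiv (hf : DifferentiableAt ℝ (fun q : ℝ × ℝ => f q.1 q.2) p) :
    pdx f p.1 p.2 = fderiv ℝ (fun q : ℝ × ℝ => f q.1 q.2) p (1, 0) :=
  (hasDerivAt_fst_of_differentiableAt hf).deriv

theorem pdu_eq_fderiv (hf : DifferentiableAt ℝ (fun q : ℝ × ℝ => f q.1 q.2) p) :
    pdu f p.1 p.2 = fderiv ℝ (fun q : ℝ × ℝ => f q.1 q.2) p (0, 1) :=
  (hasDerivAt_snd_of_differentiableAt hf).deriv

theorem hasDerivAt_pdx (hf : DifferentiableAt ℝ (fun q : ℝ × ℝ => f q.1 q.2) p) :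
    HasDerivAt (fun t => f t p.2) (pdx f p.1 p.2) p.1 :=
  (hasDerivAt_fst_of_differentiableAt hf).differentiableAt.hasDerivAt

theorem hasDerivAt_pdu (hf : DifferentiableAt ℝ (fun q : ℝ × ℝ => f q.1 q.2) p) :
    HasDerivAt (fun t => f p.1 t) (pdu f p.1 p.2) p.2 :=
  (hasDerivAt_snd_of_differentiableAt hf).differentiableAt.hasDerivAt

theorem ContDiffOn.differentiableAt_of_mem_isOpen
    (hf : ContDiffOn ℝ (⊤ : ℕ∞) (fun q : ℝ × ℝ => f q.1 q.2) U) (hU : IsOpen U) (hp : p ∈ U) :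
    DifferentiableAt ℝ (fun q : ℝ × ℝ => f q.1 q.2) p :=
  (hf.contDiffAt (hU.mem_nhds hp)).differentiableAt (by simp)

theorem ContDiffOn.pdx (hf : ContDiffOn ℝ (⊤ : ℕ∞) (fun q : ℝ × ℝ => f q.1 q.2) U)
    (hU : IsOpen U) : ContDiffOn ℝ (⊤ : ℕ∞) (fun q : ℝ × ℝ => pdx f q.1 q.2) U :=
  ((hf.fderiv_of_isOpen hU (m := (⊤ : ℕ∞)) (by simp)).clm_apply contDiffOn_const).congr
    fun _ hq => pdx_eq_fderiv (hf.differentiableAt_of_mem_isOpen hU hq)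

theorem ContDiffOn.pdu (hf : ContDiffOn ℝ (⊤ : ℕ∞) (fun q : ℝ × ℝ => f q.1 q.2) U)
    (hU : IsOpen U) : ContDiffOn ℝ (⊤ : ℕ∞) (fun q : ℝ × ℝ => pdu f q.1 q.2) U :=
  ((hf.fderiv_of_isOpen hU (m := (⊤ : ℕ∞)) (by simp)).clm_apply contDiffOn_const).congr
    fun _ hq => pdu_eq_fderiv (hf.differentiableAt_of_mem_isOpen hU hq)

/-- Mixed partial derivatives of a smooth function commute. -/
theorem pdu_pdx_eq_pdx_pdu (hf : ContDiffOn ℝ (⊤ : ℕ∞) (fun q : ℝ × ℝ => f q.1 q.2) U)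
    (hU : IsOpen U) (hp : p ∈ U) : pdu (pdx f) p.1 p.2 = pdx (pdu f) p.1 p.2 := by
  have hdiff : DifferentiableAt ℝ (fderiv ℝ fun q : ℝ × ℝ => f q.1 q.2) p :=
    ((hf.fderiv_of_isOpen hU (m := (⊤ : ℕ∞)) (by simp)).contDiffAt
      (hU.mem_nhds hp)).differentiableAt (by simp)
  have hx : (fun q : ℝ × ℝ => pdx f q.1 q.2) =ᶠ[nhds p]
      fun q => fderiv ℝ (fun q : ℝ × ℝ => f q.1 q.2) q (1, 0) := by
    filter_upwards [hU.mem_nhds hp] with q hq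
    exact pdx_eq_fderiv (hf.differentiableAt_of_mem_isOpen hU hq)
  have hu : (fun q : ℝ × ℝ => pdu f q.1 q.2) =ᶠ[nhds p]
      fun q => fderiv ℝ (fun q : ℝ × ℝ => f q.1 q.2) q (0, 1) := by
    filter_upwards [hU.mem_nhds hp] with q hq
    exact pdu_eq_fderiv (hf.differentiableAt_of_mem_isOpen hU hq)
  rw [pdu_eq_fderiv ((hf.pdx hU).differentiableAt_of_mem_isOpen hU hp),
    pdx_eq_fderiv ((hf.pdu hU).differentiableAt_of_mem_isOpen hU hp), hx.fderiv_eq, hu.fderiv_eq,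
    fderiv_clm_apply hdiff (differentiableAt_const _),
    fderiv_clm_apply hdiff (differentiableAt_const _)]
  have htwo : minSmoothness ℝ 2 ≤ ((⊤ : ℕ∞) : WithTop ℕ∞) := by
    rw [minSmoothness_of_isRCLikeNormedField]
    exact WithTop.coe_le_coe.2 (le_top : (2 : ℕ∞) ≤ ⊤)
  simpa using ((hf.contDiffAt (hU.mem_nhds hp)).isSymmSndFDerivAt htwo).eq (0, 1) (1, 0)

theorem ContDiffOn.Aop (hf : ContDiffOn ℝ (⊤ : ℕ∞) (fun q : ℝ × ℝ => f q.1 q.2) U)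
    (hg : ContDiffOn ℝ (⊤ : ℕ∞) (fun q : ℝ × ℝ => g q.1 q.2) U) (hU : IsOpen U) :
    ContDiffOn ℝ (⊤ : ℕ∞) (fun q : ℝ × ℝ => Aop f g q.1 q.2) U :=
  (hg.pdx hU).add (hf.mul (hg.pdu hU))

theorem ContDiffOn.Sfrak (hf : ContDiffOn ℝ (⊤ : ℕ∞) (fun q : ℝ × ℝ => f q.1 q.2) U)
    (hg : ContDiffOn ℝ (⊤ : ℕ∞) (fun q : ℝ × ℝ => g q.1 q.2) U) (hU : IsOpen U) :
    ContDiffOn ℝ (⊤ : ℕ∞) (fun q : ℝ × ℝ => Sfrak f g q.1 q.2) U :=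
  (hf.Aop hg hU).sub ((hf.pdu hU).mul hg)

end PartialDerivatives

/-- If `A(A(δ)) + 𝒦 δ = 0` on `U`, then the 1-form `𝔖(δ)(−φ dx + du)` is
closed on `U`. -/
theorem stmt4 (U : Set (ℝ × ℝ)) (hU : IsOpen U) (φ δ : ℝ → ℝ → ℝ)
    (hφ : ContDiffOn ℝ (⊤ : ℕ∞) (fun p : ℝ × ℝ => φ p.1 p.2) U)
    (hδ : ContDiffOn ℝ (⊤ : ℕ∞) (fun p : ℝ × ℝ => δ p.1 p.2) U)
    (hJacobi : ∀ p ∈ U,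
      Aop φ (Aop φ δ) p.1 p.2 + curvK φ p.1 p.2 * δ p.1 p.2 = 0) :
    ∀ p ∈ U, pdu (fun x u => -φ x u * Sfrak φ δ x u) p.1 p.2 =
      pdx (Sfrak φ δ) p.1 p.2 := by
  intro p hp
  have dφ := hφ.differentiableAt_of_mem_isOpen hU hp
  have dδ := hδ.differentiableAt_of_mem_isOpen hU hp
  have dφu := (hφ.pdu hU).differentiableAt_of_mem_isOpen hU hp
  have dφx := (hφ.pdx hU).differentiableAt_of_mem_isOpen hU hp
  have dAδ := (hφ.Aop hδ hU).differentiableAt_of_mem_isOpen hU hp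
  have dS := (hφ.Sfrak hδ hU).differentiableAt_of_mem_isOpen hU hp
  have hform : pdu (fun x u => -φ x u * Sfrak φ δ x u) p.1 p.2 =
      -pdu φ p.1 p.2 * Sfrak φ δ p.1 p.2 + -φ p.1 p.2 * pdu (Sfrak φ δ) p.1 p.2 :=
    ((hasDerivAt_pdu dφ).neg.mul (hasDerivAt_pdu dS)).deriv
  have hSx : pdx (Sfrak φ δ) p.1 p.2 = pdx (Aop φ δ) p.1 p.2 -
      (pdx (pdu φ) p.1 p.2 * δ p.1 p.2 + pdu φ p.1 p.2 * pdx δ p.1 p.2) :=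
    ((hasDerivAt_pdx dAδ).sub ((hasDerivAt_pdx dφu).mul (hasDerivAt_pdx dδ))).deriv
  have hSu : pdu (Sfrak φ δ) p.1 p.2 = pdu (Aop φ δ) p.1 p.2 -
      (pdu (pdu φ) p.1 p.2 * δ p.1 p.2 + pdu φ p.1 p.2 * pdu δ p.1 p.2) :=
    ((hasDerivAt_pdu dAδ).sub ((hasDerivAt_pdu dφu).mul (hasDerivAt_pdu dδ))).deriv
  have hAu : pdu (Aop φ φ) p.1 p.2 = pdu (pdx φ) p.1 p.2 +
      (pdu φ p.1 p.2 * pdu φ p.1 p.2 + φ p.1 p.2 * pdu (pdu φ) p.1 p.2) :=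
    ((hasDerivAt_pdu dφx).add ((hasDerivAt_pdu dφ).mul (hasDerivAt_pdu dφu))).deriv
  have hJ := hJacobi p hp
  rw [curvK, hAu, pdu_pdx_eq_pdx_pdu hφ hU hp, Aop] at hJ
  rw [hform, hSx, hSu, Sfrak]
  have hA : Aop φ δ p.1 p.2 = pdx δ p.1 p.2 + φ p.1 p.2 * pdu δ p.1 p.2 := rfl
  rw [hA]
  linear_combination -hJ
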